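/- Let n, m be natural numbers. Model the fermionic Fock space of n 'a'-modes and m 'c'-modes (in the particle-number basis determined by the physical operator ordering) by matrices over the index set ((Fin n → Bool) × (Fin m → Bool)), where a pair (k_a, k_c) records the occupation numbers of the a-modes and c-modes, and write wt(k) for the number of occupied modes (entries equal to true) in k. Suppose ρ : Matrix (((Fin n → Bool) × (Fin m → Bool))) (((Fin n → Bool) × (Fin m → Bool))) ℂ satisfies the fermionic superselection rule: ρ ((k_a,k_c),(l_a,l_c)) = 0 whenever wt(k_a) + wt(k_c) and wt(l_a) + wt(l_c) have different parities. Then the fermionic partial trace over the c-modes, defined entrywise by (Tr_c ρ)(k_a,l_a) = ∑_{j : Fin m → Bool} (-1)^{(wt(k_a)+wt(l_a))·wt(j)} ρ ((k_a,j),(l_a,j)) (the sign arising from anticommuting the c-operators past the a-operators), coincides with the ordinary (bosonic/qubit) partial trace, defined entrywise by (Tr_c^Bos ρ)(k_a,l_a) = ∑_{j : Fin m → Bool} ρ ((k_a,j),(l_a,j)). That is, for all k_a, l_a : Fin n → Bool, ∑_j (-1)^{(wt(k_a)+wt(l_a))·wt(j)} ρ ((k_a,j),(l_a,j)) = ∑_j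 ρ ((k_a,j),(l_a,j)). -/

import Mathlib

/-- Number of occupied modes (entries equal to `true`) in an occupation string. -/
def wt {n : ℕ} (k : Fin n → Bool) : ℕ :=
  (Finset.univ.filter (fun i => k i = true)).card

/-- For a state `ρ` of `n` a-modes and `m` c-modes satisfying the fermionic
superselection rule, the fermionic (signed) partial trace over the c-modes
coincides with the ordinary (bosonic/qubit) unsigned partial trace. -/
theorem fermionic_partial_trace_eq_bosonic (n m : ℕ)
    (ρ : Matrix ((Fin n → Bool) × (Fin m → Bool)) ((Fin n → Bool) × (Fin m → Bool)) ℂ)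
    (hss : ∀ (ka la : Fin n → Bool) (kc lc : Fin m → Bool),
      (wt ka + wt kc) % 2 ≠ (wt la + wt lc) % 2 → ρ (ka, kc) (la, lc) = 0)
    (ka la : Fin n → Bool) :
    ∑ j : Fin m → Bool, (-1 : ℂ) ^ ((wt ka + wt la) * wt j) * ρ (ka, j) (la, j)
      = ∑ j : Fin m → Bool, ρ (ka, j) (la, j) := by
  refine Finset.sum_congr rfl fun j _ => ?_
  by_cases h : (wt ka + wt j) % 2 = (wt la + wt j) % 2
  · have he : Even (wt ka + wt la) := by
      rw [Nat.even_iff]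
      omega
    rw [(he.mul_right _).neg_one_pow, one_mul]
  · rw [hss ka la j j h, mul_zero]
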